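/- arXiv:1803.08287 — 4 statements merged into one kernel-verified Lean document; each statement's English description precedes it below -/
import Mathlib

section
/- Let p₁, p₂ ∈ ℝⁿ and let Q₁, Q₂ ∈ ℝ^{n×n} be symmetric positive definite. Then for every real c > 0, the Minkowski sum of the ellipsoids E(p₁,Q₁) and E(p₂,Q₂) is contained in the ellipsoid E(p₁ + p₂, (1 + c⁻¹) Q₁ + (1 + c) Q₂); that is, for all x₁ ∈ E(p₁,Q₁) and x₂ ∈ E(p₂,Q₂), one has x₁ + x₂ ∈ E(p₁ + p₂, (1 + c⁻¹) Q₁ + (1 + c) Q₂). -/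
open Matrix

/-- The ellipsoid with center `p` and shape matrix `Q`. -/
def Ellipsoid {n : ℕ} (p : Fin n → ℝ) (Q : Matrix (Fin n) (Fin n) ℝ) : Set (Fin n → ℝ) :=
  {x | (x - p) ⬝ᵥ Q⁻¹.mulVec (x - p) ≤ 1}

/-- Young's inequality for the quadratic forms of a positive definite matrix and its inverse. -/
theorem Matrix.PosDef.two_mul_dotProduct_le {ι : Type*} [Fintype ι] [DecidableEq ι]
    {Q : Matrix ι ι ℝ} (hQ : Q.PosDef) (x y : ι → ℝ) :
    2 * (x ⬝ᵥ y) ≤ x ⬝ᵥ Q⁻¹ *ᵥ x + y ⬝ᵥ Q *ᵥ y := by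
  have hdet : IsUnit Q.det := (Matrix.isUnit_iff_isUnit_det Q).1 hQ.isUnit
  have hx : Q *ᵥ (Q⁻¹ *ᵥ x) = x := by
    rw [mulVec_mulVec, mul_nonsing_inv Q hdet, one_mulVec]
  have hQT : Qᵀ = Q := by simpa [IsHermitian] using hQ.isHermitian
  have hcross : (Q⁻¹ *ᵥ x) ⬝ᵥ Q *ᵥ y = x ⬝ᵥ y := by
    rw [dotProduct_mulVec, ← mulVec_transpose, hQT, hx]
  have h := hQ.posSemidef.dotProduct_mulVec_nonneg (Q⁻¹ *ᵥ x - y)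
  rw [star_trivial, mulVec_sub, hx, sub_dotProduct, dotProduct_sub, dotProduct_sub, hcross,
    dotProduct_comm (Q⁻¹ *ᵥ x) x, dotProduct_comm y x] at h
  linarith

/-- Weighted Young's inequality on the unit sublevel set of the form of `Q⁻¹`. -/
theorem Matrix.PosDef.two_mul_dotProduct_le_of_le_one {ι : Type*} [Fintype ι] [DecidableEq ι]
    {Q : Matrix ι ι ℝ} (hQ : Q.PosDef) {x : ι → ℝ} (hx : x ⬝ᵥ Q⁻¹ *ᵥ x ≤ 1) (y : ι → ℝ)
    {r : ℝ} (hr : 0 < r) :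
    2 * (x ⬝ᵥ y) ≤ r⁻¹ + r * (y ⬝ᵥ Q *ᵥ y) := by
  have h := hQ.two_mul_dotProduct_le x (r • y)
  simp only [mulVec_smul, dotProduct_smul, smul_dotProduct, smul_eq_mul] at h
  refine le_of_mul_le_mul_left ?_ hr
  rw [mul_add, mul_inv_cancel₀ hr.ne']
  linarith

/-- The Minkowski sum of two ellipsoids `E(p₁, Q₁) ⊕ E(p₂, Q₂)` is contained in the
ellipsoid `E(p₁ + p₂, (1 + c⁻¹) Q₁ + (1 + c) Q₂)` for every `c > 0`. -/
theorem minkowski_sum_ellipsoids_subset {n : ℕ} (p₁ p₂ : Fin n → ℝ)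
    (Q₁ Q₂ : Matrix (Fin n) (Fin n) ℝ) (hQ₁ : Q₁.PosDef) (hQ₂ : Q₂.PosDef)
    (c : ℝ) (hc : 0 < c) :
    ∀ x₁ ∈ Ellipsoid p₁ Q₁, ∀ x₂ ∈ Ellipsoid p₂ Q₂,
      x₁ + x₂ ∈ Ellipsoid (p₁ + p₂) ((1 + c⁻¹) • Q₁ + (1 + c) • Q₂) := by
  intro x₁ hx₁ x₂ hx₂
  have hα : 0 < 1 + c⁻¹ := by positivity
  have hβ : 0 < 1 + c := by positivity
  set Q := (1 + c⁻¹) • Q₁ + (1 + c) • Q₂ with hQdef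
  have hQ : Q.PosDef := (hQ₁.smul hα).add (hQ₂.smul hβ)
  have hdet : IsUnit Q.det := (Matrix.isUnit_iff_isUnit_det Q).1 hQ.isUnit
  have hz : x₁ + x₂ - (p₁ + p₂) = (x₁ - p₁) + (x₂ - p₂) := add_sub_add_comm ..
  change (x₁ + x₂ - (p₁ + p₂)) ⬝ᵥ Q⁻¹ *ᵥ (x₁ + x₂ - (p₁ + p₂)) ≤ 1
  rw [hz]
  set z := (x₁ - p₁) + (x₂ - p₂) with hzdef
  set y := Q⁻¹ *ᵥ z with hy
  have hQy : Q *ᵥ y = z := by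
    rw [hy, mulVec_mulVec, mul_nonsing_inv Q hdet, one_mulVec]
  have h₁ := hQ₁.two_mul_dotProduct_le_of_le_one hx₁ y hα
  have h₂ := hQ₂.two_mul_dotProduct_le_of_le_one hx₂ y hβ
  have hsum : z ⬝ᵥ y = (x₁ - p₁) ⬝ᵥ y + (x₂ - p₂) ⬝ᵥ y := add_dotProduct ..
  have hform : z ⬝ᵥ y = (1 + c⁻¹) * (y ⬝ᵥ Q₁ *ᵥ y) + (1 + c) * (y ⬝ᵥ Q₂ *ᵥ y) := by
    rw [dotProduct_comm, ← hQy, hQdef, add_mulVec, smul_mulVec, smul_mulVec, dotProduct_add,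
      dotProduct_smul, dotProduct_smul, smul_eq_mul, smul_eq_mul]
  have hweights : (1 + c⁻¹)⁻¹ + (1 + c)⁻¹ = 1 := by
    field_simp
    ring
  linarith
end

section
/- Let p ∈ ℝⁿ, let Q ∈ ℝ^{n×n} be symmetric positive definite, let H ∈ ℝ^{m×n} and b ∈ ℝᵐ, and let X = {x ∈ ℝⁿ : H x ≤ b} (componentwise). Then E(p,Q) ⊆ X if and only if for every row index i ∈ {1,…,m}, Hᵢ p + √(Hᵢ Q Hᵢᵀ) ≤ bᵢ, where Hᵢ denotes the i-th row of H. -/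
open Matrix

namespace Matrix.PosDef

variable {ι : Type*} [Fintype ι] [DecidableEq ι] {Q : Matrix ι ι ℝ}

theorem inv_mulVec_mulVec (hQ : Q.PosDef) (h : ι → ℝ) : Q⁻¹ *ᵥ (Q *ᵥ h) = h := by
  rw [mulVec_mulVec, nonsing_inv_mul Q ((isUnit_iff_isUnit_det Q).mp hQ.isUnit), one_mulVec]

theorem mulVec_dotProduct_inv_mulVec (hQ : Q.PosDef) (h y : ι → ℝ) :
    (Q *ᵥ h) ⬝ᵥ (Q⁻¹ *ᵥ y) = h ⬝ᵥ y := by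
  have hT : (Q⁻¹)ᵀ = Q⁻¹ := by
    simpa [IsHermitian, conjTranspose_eq_transpose_of_trivial] using hQ.inv.isHermitian.eq
  rw [dotProduct_mulVec, ← mulVec_transpose, hT, hQ.inv_mulVec_mulVec]

/-- The Cauchy-Schwarz inequality for a positive definite matrix and its inverse. -/
theorem sq_dotProduct_le (hQ : Q.PosDef) (h y : ι → ℝ) :
    (h ⬝ᵥ y) ^ 2 ≤ (h ⬝ᵥ Q *ᵥ h) * (y ⬝ᵥ Q⁻¹ *ᵥ y) := by
  have key (t : ℝ) :
      0 ≤ (h ⬝ᵥ Q *ᵥ h) * (t * t) + (-2 * (h ⬝ᵥ y)) * t + y ⬝ᵥ Q⁻¹ *ᵥ y := by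
    have hnonneg := hQ.inv.posSemidef.dotProduct_mulVec_nonneg (t • (Q *ᵥ h) - y)
    have hexpand : star (t • (Q *ᵥ h) - y) ⬝ᵥ Q⁻¹ *ᵥ (t • (Q *ᵥ h) - y) =
        (h ⬝ᵥ Q *ᵥ h) * (t * t) + (-2 * (h ⬝ᵥ y)) * t + y ⬝ᵥ Q⁻¹ *ᵥ y := by
      simp only [star_trivial, mulVec_sub, mulVec_smul, sub_dotProduct, dotProduct_sub,
        smul_dotProduct, dotProduct_smul, smul_eq_mul, hQ.inv_mulVec_mulVec,
        hQ.mulVec_dotProduct_inv_mulVec, dotProduct_comm y h, dotProduct_comm (Q *ᵥ h) h]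
      ring
    rwa [hexpand] at hnonneg
  have hdiscrim := discrim_le_zero key
  rw [discrim] at hdiscrim
  linarith

end Matrix.PosDef

/-- The ellipsoid `E(p, Q)` is contained in the polytope `{x | H x ≤ b}` (componentwise)
if and only if `Hᵢ p + √(Hᵢ Q Hᵢᵀ) ≤ bᵢ` for every row `Hᵢ` of `H`. -/
theorem ellipsoid_subset_polytope_iff {n m : ℕ} (p : Fin n → ℝ)
    (Q : Matrix (Fin n) (Fin n) ℝ) (hQ : Q.PosDef)
    (H : Matrix (Fin m) (Fin n) ℝ) (b : Fin m → ℝ) :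
    Ellipsoid p Q ⊆ {x | ∀ i, H.mulVec x i ≤ b i}
      ↔ ∀ i, H i ⬝ᵥ p + Real.sqrt (H i ⬝ᵥ Q.mulVec (H i)) ≤ b i := by
  have hq (i : Fin m) : 0 ≤ H i ⬝ᵥ Q *ᵥ H i := by
    simpa using hQ.posSemidef.dotProduct_mulVec_nonneg (H i)
  constructor
  · intro hsub i
    set s := √(H i ⬝ᵥ Q *ᵥ H i)
    have hs2 : H i ⬝ᵥ Q *ᵥ H i = s ^ 2 := (Real.sq_sqrt (hq i)).symm
    have hmem : p + s⁻¹ • (Q *ᵥ H i) ∈ Ellipsoid p Q := by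
      simp only [Ellipsoid, Set.mem_ofPred_eq, add_sub_cancel_left, mulVec_smul, smul_dotProduct,
        dotProduct_smul, smul_eq_mul, hQ.mulVec_dotProduct_inv_mulVec, hs2]
      rcases eq_or_ne s 0 with h0 | h0
      · simp [h0]
      · field_simp
        exact le_rfl
    have hle : H i ⬝ᵥ (p + s⁻¹ • (Q *ᵥ H i)) ≤ b i := hsub hmem i
    rw [dotProduct_add, dotProduct_smul, hs2, smul_eq_mul] at hle
    have hmul : s⁻¹ * s ^ 2 = s := by
      rcases eq_or_ne s 0 with h0 | h0
      · simp [h0]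
      · field_simp
    rwa [hmul] at hle
  · intro hb x hx i
    have hle : H i ⬝ᵥ (x - p) ≤ √(H i ⬝ᵥ Q *ᵥ H i) :=
      Real.le_sqrt_of_sq_le ((hQ.sq_dotProduct_le (H i) (x - p)).trans
        (mul_le_of_le_one_right (hq i) hx))
    rw [dotProduct_sub] at hle
    change H i ⬝ᵥ x ≤ b i
    linarith [hb i]
end

section
/- Let h : ℝⁿ → ℝ be differentiable with gradient ∇h Lipschitz continuous with constant L_{∇h} ≥ 0, let g : ℝⁿ → ℝ be Lipschitz continuous with constant L_g ≥ 0, and set f = h + g. Let p ∈ ℝⁿ, let Q ∈ ℝ^{n×n} be symmetric positive definite with largest eigenvalue λ_max(Q), and let μ, σ ∈ ℝ with σ ≥ 0 and β ≥ 0 satisfy |g(p) − μ| ≤ β·σ. Then for every x in the ellipsoid E(p,Q), |f(x) − (h(p) + ⟨∇h(p), x − p⟩ + μ)| ≤ β·σ + (L_{∇h}/2)·λ_max(Q) + L_g·√(λ_max(Q)). -/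
open Matrix RealInnerProductSpace

/-- Quadratic bound on the first-order Taylor remainder of a function with Lipschitz gradient. -/
theorem abs_sub_linearization_le {E : Type*} [NormedAddCommGroup E] [InnerProductSpace ℝ E]
    [CompleteSpace E] {h : E → ℝ} {L : ℝ} (hdiff : Differentiable ℝ h)
    (hlip : ∀ a b, ‖gradient h a - gradient h b‖ ≤ L * ‖a - b‖) (p y : E) :
    |h (p + y) - h p - ⟪gradient h p, y⟫| ≤ L / 2 * ‖y‖ ^ 2 := by
  have hderiv : ∀ t : ℝ, HasDerivAt (fun t : ℝ => h (p + t • y) - h p - t * ⟪gradient h p, y⟫)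
      (⟪gradient h (p + t • y), y⟫ - ⟪gradient h p, y⟫) t := by
    intro t
    have hline : HasDerivAt (fun t : ℝ => p + t • y) y t := by
      simpa using ((hasDerivAt_id t).smul_const y).const_add p
    have hcomp := (hdiff (p + t • y)).hasGradientAt.hasFDerivAt.comp_hasDerivAt t hline
    have hlin := (hasDerivAt_id t).mul_const ⟪gradient h p, y⟫
    exact ((hcomp.sub_const (h p)).sub hlin).congr_deriv (by simp)
  have hB : ∀ t : ℝ, HasDerivAt (fun t : ℝ => L / 2 * ‖y‖ ^ 2 * t ^ 2) (L * ‖y‖ ^ 2 * t) t := by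
    intro t
    exact ((hasDerivAt_pow 2 t).const_mul (L / 2 * ‖y‖ ^ 2)).congr_deriv (by push_cast; ring)
  have key := image_norm_le_of_norm_deriv_right_le_deriv_boundary (a := 0) (b := 1)
    (fun t _ => (hderiv t).continuousAt.continuousWithinAt)
    (fun t _ => (hderiv t).hasDerivWithinAt) (by simp) hB
    (fun t ht => by
      rw [← inner_sub_left]
      have h1 := hlip (p + t • y) p
      rw [add_sub_cancel_left, norm_smul, Real.norm_of_nonneg ht.1] at h1
      calc _ ≤ ‖gradient h (p + t • y) - gradient h p‖ * ‖y‖ := norm_inner_le_norm _ _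
        _ ≤ L * (t * ‖y‖) * ‖y‖ := by gcongr
        _ = L * ‖y‖ ^ 2 * t := by ring)
    (Set.right_mem_Icc.2 zero_le_one)
  simpa using key

/-- The quadratic form of the inverse of a positive definite matrix, times the largest eigenvalue,
dominates the squared Euclidean norm. -/
theorem norm_sq_le_iSup_eigenvalues_mul {ι : Type*} [Fintype ι] [DecidableEq ι]
    {Q : Matrix ι ι ℝ} (hQ : Q.PosDef) (y : EuclideanSpace ℝ ι) :
    ‖y‖ ^ 2 ≤ (⨆ i, hQ.1.eigenvalues i) * (y.ofLp ⬝ᵥ Q⁻¹ *ᵥ y.ofLp) := by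
  set v := hQ.1.eigenvectorBasis
  set d := hQ.1.eigenvalues
  have hd : ∀ i, 0 < d i := hQ.eigenvalues_pos
  have hunit : IsUnit Q.det := hQ.det_pos.ne'.isUnit
  have hinv : ∀ i, Q⁻¹ *ᵥ (v i).ofLp = (d i)⁻¹ • (v i).ofLp := by
    intro i
    have h1 : Q *ᵥ (v i).ofLp = d i • (v i).ofLp := hQ.1.mulVec_eigenvectorBasis i
    have h2 : Q⁻¹ *ᵥ (Q *ᵥ (v i).ofLp) = (v i).ofLp := by
      rw [mulVec_mulVec, nonsing_inv_mul _ hunit, one_mulVec]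
    rw [h1, mulVec_smul] at h2
    rw [eq_inv_smul_iff₀ (hd i).ne', h2]
  have hsymm : Q⁻¹ᵀ = Q⁻¹ := by simpa using hQ.inv.1.eq
  have hcoord : ∀ i, ⟪v i, WithLp.toLp 2 (Q⁻¹ *ᵥ y.ofLp)⟫ = (d i)⁻¹ * ⟪y, v i⟫ := by
    intro i
    simp only [EuclideanSpace.inner_eq_star_dotProduct, star_trivial]
    rw [dotProduct_comm, dotProduct_mulVec, ← mulVec_transpose, hsymm, hinv, smul_dotProduct,
      smul_eq_mul]
  have hform : y.ofLp ⬝ᵥ Q⁻¹ *ᵥ y.ofLp = ∑ i, (d i)⁻¹ * ⟪y, v i⟫ ^ 2 := by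
    have h1 := v.sum_inner_mul_inner y (WithLp.toLp 2 (Q⁻¹ *ᵥ y.ofLp))
    rw [EuclideanSpace.inner_eq_star_dotProduct, star_trivial, dotProduct_comm] at h1
    rw [← h1]
    refine Finset.sum_congr rfl fun i _ => ?_
    rw [hcoord]
    ring
  have hnorm : ‖y‖ ^ 2 = ∑ i, ⟪y, v i⟫ ^ 2 := by
    rw [← real_inner_self_eq_norm_sq, ← v.sum_inner_mul_inner y y]
    refine Finset.sum_congr rfl fun i _ => ?_
    rw [real_inner_comm y (v i), sq]
  rw [hform, hnorm, Finset.mul_sum]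
  refine Finset.sum_le_sum fun i _ => ?_
  rw [← mul_assoc, ← div_eq_mul_inv]
  exact le_mul_of_one_le_left (sq_nonneg _)
    ((one_le_div (hd i)).2 (le_ciSup (Set.finite_range d).bddAbove i))

/-- One-step over-approximation bound on an ellipsoid: under the Lipschitz assumptions on
`∇h` and `g`, and the statistical confidence bound `|g(p) - μ| ≤ β σ` at the center `p`,
for every `x` in the ellipsoid `E(p, Q)`,
`|f(x) - (h(p) + ⟨∇h(p), x - p⟩ + μ)| ≤ β σ + (Lgh / 2) λ_max(Q) + Lg √(λ_max(Q))`. -/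
theorem one_step_overapproximation_bound {n : ℕ} (hn : 0 < n)
    (h g : EuclideanSpace ℝ (Fin n) → ℝ)
    (Lgh Lg : ℝ) (hLgh : 0 ≤ Lgh) (hLg : 0 ≤ Lg)
    (hdiff : Differentiable ℝ h)
    (hgradLip : ∀ a b, ‖gradient h a - gradient h b‖ ≤ Lgh * ‖a - b‖)
    (hgLip : ∀ a b, |g a - g b| ≤ Lg * ‖a - b‖)
    (f : EuclideanSpace ℝ (Fin n) → ℝ) (hf : f = h + g)
    (p : EuclideanSpace ℝ (Fin n)) (Q : Matrix (Fin n) (Fin n) ℝ) (hQ : Q.PosDef)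
    (μ σ β : ℝ) (hσ : 0 ≤ σ) (hβ : 0 ≤ β) (hpred : |g p - μ| ≤ β * σ) :
    ∀ x : EuclideanSpace ℝ (Fin n),
      (x - p) ⬝ᵥ Q⁻¹.mulVec (x - p) ≤ 1 →
        |f x - (h p + ⟪gradient h p, x - p⟫ + μ)|
          ≤ β * σ + Lgh / 2 * (⨆ i, hQ.1.eigenvalues i)
            + Lg * Real.sqrt (⨆ i, hQ.1.eigenvalues i) := by
  intro x hx
  subst hf
  set l := ⨆ i, hQ.1.eigenvalues i
  have hl : 0 ≤ l := Real.iSup_nonneg fun i => (hQ.eigenvalues_pos i).le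
  have hsq : ‖x - p‖ ^ 2 ≤ l :=
    (norm_sq_le_iSup_eigenvalues_mul hQ (x - p)).trans (mul_le_of_le_one_right hl hx)
  have hnorm : ‖x - p‖ ≤ Real.sqrt l := Real.le_sqrt_of_sq_le hsq
  have htaylor := abs_sub_linearization_le hdiff hgradLip p (x - p)
  rw [add_sub_cancel] at htaylor
  calc |(h + g) x - (h p + ⟪gradient h p, x - p⟫ + μ)|
      = |(g p - μ) + (h x - h p - ⟪gradient h p, x - p⟫) + (g x - g p)| := by
        rw [Pi.add_apply]
        ring_nf
    _ ≤ |g p - μ| + |h x - h p - ⟪gradient h p, x - p⟫| + |g x - g p| := abs_add_three _ _ _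
    _ ≤ β * σ + Lgh / 2 * l + Lg * Real.sqrt l := by
        gcongr
        · exact htaylor.trans (by gcongr)
        · exact (hgLip x p).trans (by gcongr)
end

section
/- Let p, u ∈ ℝ-vector spaces ℝⁿ and ℝᵐ respectively, let Q ∈ ℝ^{n×n} be symmetric positive definite, let K ∈ ℝ^{m×n}, and define the affine state-feedback law π(x) = K(x − p) + u. Then for any h ∈ ℝᵐ and c ∈ ℝ, the image π(E(p,Q)) is contained in the halfspace {v ∈ ℝᵐ : hᵀv ≤ c} if and only if hᵀu + √(hᵀ K Q Kᵀ h) ≤ c. -/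
open Matrix

/-- Expansion of the quadratic form of `Q⁻¹` along a line in direction `Q w`. -/
lemma Matrix.PosDef.dotProduct_inv_mulVec_sub_smul {n : ℕ} {Q : Matrix (Fin n) (Fin n) ℝ}
    (hQ : Q.PosDef) (w z : Fin n → ℝ) (t : ℝ) :
    (z - t • Q *ᵥ w) ⬝ᵥ Q⁻¹ *ᵥ (z - t • Q *ᵥ w) =
      (w ⬝ᵥ Q *ᵥ w) * (t * t) + (-2 * (w ⬝ᵥ z)) * t + z ⬝ᵥ Q⁻¹ *ᵥ z := by
  have hdet : IsUnit Q.det := (Matrix.isUnit_iff_isUnit_det Q).mp hQ.isUnit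
  have hsymm : Qᵀ = Q := by simpa using hQ.isHermitian.eq
  have hinv : Q⁻¹ *ᵥ (Q *ᵥ w) = w := by
    rw [mulVec_mulVec, nonsing_inv_mul Q hdet, one_mulVec]
  have hcross : (Q *ᵥ w) ⬝ᵥ Q⁻¹ *ᵥ z = w ⬝ᵥ z := by
    rw [← vecMul_transpose, hsymm, ← dotProduct_mulVec, mulVec_mulVec, mul_nonsing_inv Q hdet,
      one_mulVec]
  simp only [mulVec_sub, mulVec_smul, hinv, sub_dotProduct, dotProduct_sub, smul_dotProduct,
    dotProduct_smul, hcross, smul_eq_mul, dotProduct_comm z w, dotProduct_comm (Q *ᵥ w) w]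
  ring

/-- Cauchy–Schwarz inequality for the dual pair of quadratic forms of `Q` and `Q⁻¹`. -/
lemma Matrix.PosDef.sq_dotProduct_le_s12 {n : ℕ} {Q : Matrix (Fin n) (Fin n) ℝ}
    (hQ : Q.PosDef) (w z : Fin n → ℝ) :
    (w ⬝ᵥ z) ^ 2 ≤ (w ⬝ᵥ Q *ᵥ w) * (z ⬝ᵥ Q⁻¹ *ᵥ z) := by
  have hdiscrim := discrim_le_zero fun t : ℝ => by
    rw [← hQ.dotProduct_inv_mulVec_sub_smul w z t]
    simpa using hQ.inv.posSemidef.dotProduct_mulVec_nonneg (z - t • Q *ᵥ w)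
  rw [discrim] at hdiscrim
  linarith

/-- For the affine state-feedback law `π(x) = K (x - p) + u`, the image `π(E(p, Q))` is
contained in the halfspace `{v | hᵀ v ≤ c}` if and only if
`hᵀ u + √(hᵀ K Q Kᵀ h) ≤ c`. -/
theorem feedback_image_subset_halfspace_iff {n m : ℕ}
    (p : Fin n → ℝ) (u : Fin m → ℝ)
    (Q : Matrix (Fin n) (Fin n) ℝ) (hQ : Q.PosDef)
    (K : Matrix (Fin m) (Fin n) ℝ) (h : Fin m → ℝ) (c : ℝ) :
    (fun x => K.mulVec (x - p) + u) '' Ellipsoid p Q ⊆ {v | h ⬝ᵥ v ≤ c}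
      ↔ h ⬝ᵥ u + Real.sqrt (h ⬝ᵥ (K * Q * Kᵀ).mulVec h) ≤ c := by
  have hpair (z : Fin n → ℝ) : h ⬝ᵥ K *ᵥ z = (Kᵀ *ᵥ h) ⬝ᵥ z := by
    rw [dotProduct_mulVec, mulVec_transpose]
  have hform : h ⬝ᵥ (K * Q * Kᵀ) *ᵥ h = (Kᵀ *ᵥ h) ⬝ᵥ Q *ᵥ (Kᵀ *ᵥ h) := by
    rw [← mulVec_mulVec, ← mulVec_mulVec, hpair]
  rw [hform]
  set w := Kᵀ *ᵥ h
  have hnonneg : 0 ≤ w ⬝ᵥ Q *ᵥ w := by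
    simpa using hQ.posSemidef.dotProduct_mulVec_nonneg w
  rw [Set.image_subset_iff]
  constructor
  · intro hsub
    set s := √(w ⬝ᵥ Q *ᵥ w)
    have hsq : w ⬝ᵥ Q *ᵥ w = s * s := (Real.mul_self_sqrt hnonneg).symm
    have hmem : p + s⁻¹ • Q *ᵥ w ∈ Ellipsoid p Q := by
      have hexp := hQ.dotProduct_inv_mulVec_sub_smul w 0 (-s⁻¹)
      simp only [neg_smul, sub_neg_eq_add, zero_add, dotProduct_zero, zero_dotProduct, hsq]
        at hexp
      simp only [Ellipsoid, Set.mem_ofPred_eq, add_sub_cancel_left, hexp]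
      rcases eq_or_ne s 0 with h0 | h0
      · simp [h0]
      · field_simp
        simp [h0]
    have hle := hsub hmem
    simp only [Set.mem_preimage, Set.mem_ofPred_eq, add_sub_cancel_left, dotProduct_add, hpair,
      dotProduct_smul, smul_eq_mul, hsq] at hle
    have hval : s⁻¹ * (s * s) = s := by
      rcases eq_or_ne s 0 with h0 | h0
      · simp [h0]
      · field_simp
    linarith
  · intro hle x hx
    have hbound : w ⬝ᵥ (x - p) ≤ √(w ⬝ᵥ Q *ᵥ w) :=
      Real.le_sqrt_of_sq_le
        ((hQ.sq_dotProduct_le_s12 w (x - p)).trans (mul_le_of_le_one_right hnonneg hx))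
    simp only [Set.mem_preimage, Set.mem_ofPred_eq, dotProduct_add, hpair]
    linarith
end
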